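/- arXiv:1003.4179 — 5 statements merged into one kernel-verified Lean document; each statement's English description precedes it below -/
import Mathlib

section
/- Let E be a complete geodesic space with no bifurcating geodesics and the geodesic extension property, and let A be a nonempty compact subset of E. Then the set W_max = { X ∈ P_{cp}(E) : max(A,X) is well-posed } is a dense G_δ-set in the metric space (P_{cp}(E), h), where P_{cp}(E) is the family of nonempty compact subsets of E with the Pompeiu-Hausdorff distance. -/
open Metric Set Filter Bornology

noncomputable section

/-- A geodesic path of length `l`: a map `c : ℝ → E` that is isometric on `[0, l]`. -/
def IsGeodesicPath {E : Type*} [MetricSpace E] (c : ℝ → E) (l : ℝ) : Prop :=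
  0 ≤ l ∧ ∀ s ∈ Icc (0:ℝ) l, ∀ t ∈ Icc (0:ℝ) l, dist (c s) (c t) = |s - t|

/-- `S` is a geodesic segment joining `x` and `y`. -/
def IsGeodesicSegment {E : Type*} [MetricSpace E] (S : Set E) (x y : E) : Prop :=
  ∃ c l, IsGeodesicPath c l ∧ c 0 = x ∧ c l = y ∧ S = c '' Icc (0:ℝ) l

/-- A geodesic (line): an isometric image of `ℝ`. -/
def IsGeodesicLine {E : Type*} [MetricSpace E] (S : Set E) : Prop :=
  ∃ c : ℝ → E, Isometry c ∧ S = Set.range c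

/-- `E` is a geodesic space: every two points are joined by a geodesic path. -/
def IsGeodesicSpace (E : Type*) [MetricSpace E] : Prop :=
  ∀ x y : E, ∃ S, IsGeodesicSegment S x y

/-- `E` has the geodesic extension property: every geodesic segment is contained
in a geodesic. -/
def GeodesicExtensionProperty (E : Type*) [MetricSpace E] : Prop :=
  ∀ (S : Set E) (x y : E), IsGeodesicSegment S x y → ∃ L, IsGeodesicLine L ∧ S ⊆ L

/-- The metric of `E` is convex. -/
def HasConvexMetric (E : Type*) [MetricSpace E] : Prop :=
  ∀ (c₁ c₂ : ℝ → E) (l₁ l₂ : ℝ), IsGeodesicPath c₁ l₁ → IsGeodesicPath c₂ l₂ →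
    ∀ t ∈ Icc (0:ℝ) 1,
      dist (c₁ (t * l₁)) (c₂ (t * l₂)) ≤
        (1 - t) * dist (c₁ 0) (c₂ 0) + t * dist (c₁ l₁) (c₂ l₂)

/-- A subset `X` is (geodesically) convex: any geodesic segment joining two points
of `X` is contained in `X`. -/
def GeodesicConvex {E : Type*} [MetricSpace E] (X : Set E) : Prop :=
  ∀ x ∈ X, ∀ y ∈ X, ∀ S : Set E, IsGeodesicSegment S x y → S ⊆ X

/-- A function `f : E → ℝ` is (geodesically) convex. -/
def GeodesicConvexFun {E : Type*} [MetricSpace E] (f : E → ℝ) : Prop :=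
  ∀ (c : ℝ → E) (l : ℝ), IsGeodesicPath c l → ∀ t ∈ Icc (0:ℝ) 1,
    f (c (t * l)) ≤ (1 - t) * f (c 0) + t * f (c l)

/-- `G₁(S)`: the union of all geodesic segments with endpoints in `S`. -/
def geodSegUnion {E : Type*} [MetricSpace E] (S : Set E) : Set E :=
  {z | ∃ x ∈ S, ∃ y ∈ S, ∃ T : Set E, IsGeodesicSegment T x y ∧ z ∈ T}

/-- The iterates `G_n(S)`. -/
def geodGn {E : Type*} [MetricSpace E] (S : Set E) : ℕ → Set E
  | 0 => S
  | n + 1 => geodSegUnion (geodGn S n)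

/-- The (geodesic) convex hull `co(S) = ⋃ₙ G_n(S)`. -/
def geodConvexHull {E : Type*} [MetricSpace E] (S : Set E) : Set E :=
  ⋃ n, geodGn S n

/-- `E` is without bifurcating geodesics. -/
def NoBifurcatingGeodesics (E : Type*) [MetricSpace E] : Prop :=
  ∀ (p a b : E) (S₁ S₂ : Set E), IsGeodesicSegment S₁ p a → IsGeodesicSegment S₂ p b →
    ∀ z, z ∈ S₁ → z ∈ S₂ → z ≠ p → (z = a ∧ z = b) ∨ S₁ ⊆ S₂ ∨ S₂ ⊆ S₁

/-- `E` is reflexive: every descending sequence of nonempty, bounded, closed and convex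
subsets of `E` has nonempty intersection. -/
def ReflexiveGeodesicSpace (E : Type*) [MetricSpace E] : Prop :=
  ∀ C : ℕ → Set E, (∀ n, (C n).Nonempty) → (∀ n, IsBounded (C n)) → (∀ n, IsClosed (C n)) →
    (∀ n, GeodesicConvex (C n)) → (∀ n, C (n + 1) ⊆ C n) → (⋂ n, C n).Nonempty

/-- `Dist(x, A)`: the remotal (farthest) distance from `x` to `A`. -/
def supDist {E : Type*} [MetricSpace E] (x : E) (A : Set E) : ℝ :=
  sSup ((fun a => dist x a) '' A)

/-- `λ_{XY} = inf{ d(x,y) : x ∈ X, y ∈ Y }`. -/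
def infSetDist {E : Type*} [MetricSpace E] (X Y : Set E) : ℝ :=
  sInf (Set.image2 dist X Y)

/-- `μ_{XY} = sup{ d(x,y) : x ∈ X, y ∈ Y }`. -/
def supSetDist {E : Type*} [MetricSpace E] (X Y : Set E) : ℝ :=
  sSup (Set.image2 dist X Y)

/-- `L_{XY}(σ) = { x ∈ X : dist(x,Y) ≤ λ_{XY} + σ }`. -/
def Lset {E : Type*} [MetricSpace E] (X Y : Set E) (σ : ℝ) : Set E :=
  {x ∈ X | infDist x Y ≤ infSetDist X Y + σ}

/-- `M_{XY}(σ) = { x ∈ X : Dist(x,Y) ≥ μ_{XY} − σ }`. -/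
def Mset {E : Type*} [MetricSpace E] (X Y : Set E) (σ : ℝ) : Set E :=
  {x ∈ X | supSetDist X Y - σ ≤ supDist x Y}

/-- The minimization problem `min(X,Y)` is well-posed. -/
def MinWellPosed {E : Type*} [MetricSpace E] (X Y : Set E) : Prop :=
  ∃ x₀ ∈ X, ∃ y₀ ∈ Y, dist x₀ y₀ = infSetDist X Y ∧
    (∀ x ∈ X, ∀ y ∈ Y, dist x y = infSetDist X Y → x = x₀ ∧ y = y₀) ∧
    ∀ x : ℕ → E, ∀ y : ℕ → E, (∀ n, x n ∈ X) → (∀ n, y n ∈ Y) →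
      Tendsto (fun n => dist (x n) (y n)) atTop (nhds (infSetDist X Y)) →
      Tendsto x atTop (nhds x₀) ∧ Tendsto y atTop (nhds y₀)

/-- The maximization problem `max(X,Y)` is well-posed. -/
def MaxWellPosed {E : Type*} [MetricSpace E] (X Y : Set E) : Prop :=
  ∃ x₀ ∈ X, ∃ y₀ ∈ Y, dist x₀ y₀ = supSetDist X Y ∧
    (∀ x ∈ X, ∀ y ∈ Y, dist x y = supSetDist X Y → x = x₀ ∧ y = y₀) ∧
    ∀ x : ℕ → E, ∀ y : ℕ → E, (∀ n, x n ∈ X) → (∀ n, y n ∈ Y) →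
      Tendsto (fun n => dist (x n) (y n)) atTop (nhds (supSetDist X Y)) →
      Tendsto x atTop (nhds x₀) ∧ Tendsto y atTop (nhds y₀)

/-- The distance of the model space `M²_κ` (κ < 0): the hyperbolic distance
multiplied by `1/√(-κ)`. -/
def kdist (κ : ℝ) (a b : UpperHalfPlane) : ℝ :=
  (Real.sqrt (-κ))⁻¹ * dist a b

/-- `pb` is the comparison point in `M²_κ` (relative to the side from `xi` to `xj`,
with comparison vertices `xib`, `xjb`) of a point `p` on a geodesic segment from
`xi` to `xj`. -/
def IsComparisonPoint {E : Type*} [MetricSpace E] (κ : ℝ) (xi xj : E)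
    (xib xjb : UpperHalfPlane) (p : E) (pb : UpperHalfPlane) : Prop :=
  kdist κ xib pb = dist xi p ∧ kdist κ pb xjb = dist p xj

/-- `E` has curvature bounded below by `κ < 0`: every geodesic triangle satisfies the
reversed CAT(κ) inequality with respect to any κ-comparison triangle in `M²_κ`. -/
def CurvBoundedBelow (E : Type*) [MetricSpace E] (κ : ℝ) : Prop :=
  ∀ (x₁ x₂ x₃ : E) (S₁₂ S₂₃ S₁₃ : Set E),
    IsGeodesicSegment S₁₂ x₁ x₂ → IsGeodesicSegment S₂₃ x₂ x₃ → IsGeodesicSegment S₁₃ x₁ x₃ →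
    ∀ x₁b x₂b x₃b : UpperHalfPlane,
      kdist κ x₁b x₂b = dist x₁ x₂ → kdist κ x₂b x₃b = dist x₂ x₃ →
      kdist κ x₁b x₃b = dist x₁ x₃ →
      ∀ (p q : E) (pb qb : UpperHalfPlane),
        ((p ∈ S₁₂ ∧ IsComparisonPoint κ x₁ x₂ x₁b x₂b p pb) ∨
         (p ∈ S₂₃ ∧ IsComparisonPoint κ x₂ x₃ x₂b x₃b p pb) ∨
         (p ∈ S₁₃ ∧ IsComparisonPoint κ x₁ x₃ x₁b x₃b p pb)) →
        ((q ∈ S₁₂ ∧ IsComparisonPoint κ x₁ x₂ x₁b x₂b q qb) ∨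
         (q ∈ S₂₃ ∧ IsComparisonPoint κ x₂ x₃ x₂b x₃b q qb) ∨
         (q ∈ S₁₃ ∧ IsComparisonPoint κ x₁ x₃ x₁b x₃b q qb)) →
        kdist κ pb qb ≤ dist p q

/-- Comparison points for Euclidean (κ = 0) comparison triangles in `ℝ²`. -/
def IsComparisonPointE {E : Type*} [MetricSpace E] (xi xj : E)
    (xib xjb : EuclideanSpace ℝ (Fin 2)) (p : E) (pb : EuclideanSpace ℝ (Fin 2)) : Prop :=
  dist xib pb = dist xi p ∧ dist pb xjb = dist p xj

/-- `E` is a CAT(0) space: a geodesic space where every geodesic triangle satisfies the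
CAT(0) comparison inequality with respect to Euclidean comparison triangles. -/
def CATZero (E : Type*) [MetricSpace E] : Prop :=
  IsGeodesicSpace E ∧
  ∀ (x₁ x₂ x₃ : E) (S₁₂ S₂₃ S₁₃ : Set E),
    IsGeodesicSegment S₁₂ x₁ x₂ → IsGeodesicSegment S₂₃ x₂ x₃ → IsGeodesicSegment S₁₃ x₁ x₃ →
    ∀ x₁b x₂b x₃b : EuclideanSpace ℝ (Fin 2),
      dist x₁b x₂b = dist x₁ x₂ → dist x₂b x₃b = dist x₂ x₃ → dist x₁b x₃b = dist x₁ x₃ →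
      ∀ (p q : E) (pb qb : EuclideanSpace ℝ (Fin 2)),
        ((p ∈ S₁₂ ∧ IsComparisonPointE x₁ x₂ x₁b x₂b p pb) ∨
         (p ∈ S₂₃ ∧ IsComparisonPointE x₂ x₃ x₂b x₃b p pb) ∨
         (p ∈ S₁₃ ∧ IsComparisonPointE x₁ x₃ x₁b x₃b p pb)) →
        ((q ∈ S₁₂ ∧ IsComparisonPointE x₁ x₂ x₁b x₂b q qb) ∨
         (q ∈ S₂₃ ∧ IsComparisonPointE x₂ x₃ x₂b x₃b q qb) ∨
         (q ∈ S₁₃ ∧ IsComparisonPointE x₁ x₃ x₁b x₃b q qb)) →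
        dist p q ≤ dist pb qb

/-- The space `P_{b,cl,cv}(E)` of nonempty, bounded, closed and convex subsets of `E`. -/
def Pbclcv (E : Type*) [MetricSpace E] : Type _ :=
  {X : Set E // X.Nonempty ∧ IsBounded X ∧ IsClosed X ∧ GeodesicConvex X}

/-- `P_{b,cl,cv}(E)` carries the Pompeiu-Hausdorff distance. -/
instance Pbclcv.metricSpace (E : Type*) [MetricSpace E] : MetricSpace (Pbclcv E) where
  dist X Y := hausdorffDist X.1 Y.1
  dist_self X := hausdorffDist_self_zero
  dist_comm X Y := hausdorffDist_comm
  dist_triangle X Y Z := hausdorffDist_triangle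
    (hausdorffEdist_ne_top_of_nonempty_of_bounded X.2.1 Y.2.1 X.2.2.1 Y.2.2.1)
  eq_of_dist_eq_zero := by
    intro X Y h
    exact Subtype.ext ((X.2.2.2.1.hausdorffDist_zero_iff_eq Y.2.2.2.1
      (hausdorffEdist_ne_top_of_nonempty_of_bounded X.2.1 Y.2.1 X.2.2.1 Y.2.2.1)).mp h)

/-- `P^A_{b,cl,cv}(E)`: the closure in `(P_{b,cl,cv}(E), h)` of the family of sets at
positive distance from `A`. -/
def PAbclcv {E : Type*} [MetricSpace E] (A : Set E) : Set (Pbclcv E) :=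
  closure {X : Pbclcv E | 0 < infSetDist X.1 A}

/-- The inverse hyperbolic cosine. -/
def arcosh (x : ℝ) : ℝ := Real.log (x + Real.sqrt (x ^ 2 - 1))

/-- The function `F_κ`. -/
def Fkappa (κ d r σ : ℝ) : ℝ :=
  2 / Real.sqrt (-κ) *
    arcosh (Real.cosh (Real.sqrt (-κ) * (r - d + σ)) ^ 2 -
      Real.sinh (Real.sqrt (-κ) * (r - d + σ)) / Real.sinh (Real.sqrt (-κ) * d) *
        (Real.cosh (Real.sqrt (-κ) * r) -
          Real.cosh (Real.sqrt (-κ) * d) * Real.cosh (Real.sqrt (-κ) * (r - d + σ))))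

/-- The petal `P_{α,δ}(x₀, f)`. -/
def petal {E : Type*} [MetricSpace E] (f : E → ℝ) (α δ : ℝ) (x₀ : E) : Set E :=
  {x | f x ≤ f x₀ - α * dist x x₀ + δ}

/-- `L_{A,f}(σ)`. -/
def LsetFun {E : Type*} [MetricSpace E] (A : Set E) (f : E → ℝ) (σ : ℝ) : Set E :=
  {x | f x ≤ sInf (f '' A) + σ ∧ infDist x A ≤ σ}

/-- The problem `min(A,f)` is well-posed in the sense of Revalski. -/
def RevalskiWellPosed {E : Type*} [MetricSpace E] (A : Set E) (f : E → ℝ) : Prop :=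
  sInf ((fun σ => diam (LsetFun A f σ)) '' Ioi 0) = 0

/-- The nearest point problem `min(X,y)` is well-posed. -/
def PointMinWellPosed {E : Type*} [MetricSpace E] (X : Set E) (y : E) : Prop :=
  ∃ x₀ ∈ X, dist x₀ y = infDist y X ∧ (∀ x ∈ X, dist x y = infDist y X → x = x₀) ∧
    ∀ x : ℕ → E, (∀ n, x n ∈ X) →
      Tendsto (fun n => dist (x n) y) atTop (nhds (infDist y X)) →
      Tendsto x atTop (nhds x₀)

end

section Geodesics

variable {E : Type*} [MetricSpace E]

theorem IsGeodesicPath.of_le {c : ℝ → E} {l : ℝ} (hl : 0 ≤ l)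
    (h : ∀ s t, 0 ≤ s → s ≤ t → t ≤ l → dist (c s) (c t) = t - s) : IsGeodesicPath c l := by
  refine ⟨hl, fun s hs t ht => ?_⟩
  rcases le_total s t with hst | hst
  · rw [h s t hs.1 hst ht.2, abs_sub_comm, abs_of_nonneg (sub_nonneg.2 hst)]
  · rw [dist_comm, h t s ht.1 hst hs.2, abs_of_nonneg (sub_nonneg.2 hst)]

theorem IsGeodesicPath.dist_eq {c : ℝ → E} {l s t : ℝ} (h : IsGeodesicPath c l)
    (hs : 0 ≤ s) (hst : s ≤ t) (ht : t ≤ l) : dist (c s) (c t) = t - s := by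
  rw [h.2 s ⟨hs, hst.trans ht⟩ t ⟨hs.trans hst, ht⟩, abs_sub_comm,
    abs_of_nonneg (sub_nonneg.2 hst)]

theorem IsGeodesicPath.concat {c₁ c₂ : ℝ → E} {l₁ l₂ : ℝ} (h₁ : IsGeodesicPath c₁ l₁)
    (h₂ : IsGeodesicPath c₂ l₂) (hc : c₁ l₁ = c₂ 0) (hd : dist (c₁ 0) (c₂ l₂) = l₁ + l₂) :
    IsGeodesicPath (fun t => if t ≤ l₁ then c₁ t else c₂ (t - l₁)) (l₁ + l₂) := by
  have hl₁ := h₁.1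
  have hl₂ := h₂.1
  refine IsGeodesicPath.of_le (add_nonneg hl₁ hl₂) fun s t hs hst ht => ?_
  by_cases hs' : s ≤ l₁
  · by_cases ht' : t ≤ l₁
    · simpa [hs', ht'] using h₁.dist_eq hs hst ht'
    · have e₁ := h₁.dist_eq hs hs' le_rfl
      have e₂ := h₂.dist_eq (s := 0) (t := t - l₁) le_rfl (by linarith) (by linarith)
      have e₃ := h₁.dist_eq le_rfl hs hs'
      have e₄ := h₂.dist_eq (s := t - l₁) (t := l₂) (by linarith) (by linarith) le_rfl
      have t₁ := dist_triangle (c₁ s) (c₁ l₁) (c₂ (t - l₁))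
      have t₂ := dist_triangle4 (c₁ 0) (c₁ s) (c₂ (t - l₁)) (c₂ l₂)
      rw [hc] at t₁ e₁
      simp only [hs', ht', if_true, if_false]
      linarith
  · have ht' : ¬t ≤ l₁ := by linarith
    simp only [hs', ht', if_false]
    rw [h₂.dist_eq (by linarith) (by linarith) (by linarith)]
    ring

theorem IsGeodesicSegment.eq_of_dist_eq {S : Set E} {x y w : E} (h : IsGeodesicSegment S x y)
    (hw : w ∈ S) (hd : dist x w = dist x y) : w = y := by
  obtain ⟨c, l, hc, rfl, rfl, rfl⟩ := h
  obtain ⟨t, ht, rfl⟩ := hw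
  rw [hc.dist_eq le_rfl ht.1 ht.2, hc.dist_eq le_rfl hc.1 le_rfl] at hd
  rw [sub_left_inj.1 hd]

theorem IsGeodesicSegment.right_mem {S : Set E} {x y : E} (h : IsGeodesicSegment S x y) :
    y ∈ S := by
  obtain ⟨c, l, hc, -, rfl, rfl⟩ := h
  exact ⟨l, ⟨hc.1, le_rfl⟩, rfl⟩

/-- A point realizing equality in the triangle inequality lies on a geodesic segment. -/
theorem IsGeodesicSpace.exists_segment_through (hgeo : IsGeodesicSpace E) {x y z : E}
    (h : dist x y + dist y z = dist x z) : ∃ S, IsGeodesicSegment S x z ∧ y ∈ S := by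
  obtain ⟨-, c₁, l₁, h₁, rfl, rfl, -⟩ := hgeo x y
  obtain ⟨-, c₂, l₂, h₂, hc, rfl, -⟩ := hgeo (c₁ l₁) z
  have e₁ := h₁.dist_eq le_rfl h₁.1 le_rfl
  have e₂ := h₂.dist_eq le_rfl h₂.1 le_rfl
  rw [hc] at e₂
  refine ⟨_, ⟨_, _, h₁.concat h₂ hc.symm (by linarith), ?_, ?_, rfl⟩, l₁,
    ⟨h₁.1, by linarith [h₂.1]⟩, by simp⟩
  · simp [h₁.1]
  · rcases h₂.1.eq_or_lt with h0 | h0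
    · simp [← h0, hc]
    · simp [h0]

/-- Every segment can be prolonged beyond its endpoint by any prescribed length. -/
theorem GeodesicExtensionProperty.exists_prolongation (hext : GeodesicExtensionProperty E)
    (hgeo : IsGeodesicSpace E) (a x : E) {ε : ℝ} (hε : 0 ≤ ε) :
    ∃ y, dist x y = ε ∧ dist a y = dist a x + ε := by
  obtain ⟨S, hS⟩ := hgeo a x
  obtain ⟨-, ⟨c, hc, rfl⟩, hSL⟩ := hext S a x hS
  obtain ⟨t, rfl⟩ := hSL hS.right_mem
  obtain ⟨d, l, hd, rfl, -, rfl⟩ := hS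
  obtain ⟨s, hs⟩ := hSL ⟨0, ⟨le_rfl, hd.1⟩, rfl⟩
  rw [← hs]
  simp only [hc.dist_eq, Real.dist_eq]
  rcases le_total s t with hst | hst
  · refine ⟨c (t + ε), ?_, ?_⟩ <;> rw [hc.dist_eq, Real.dist_eq]
    · rw [abs_of_nonpos] <;> linarith
    · rw [abs_of_nonpos, abs_of_nonpos] <;> linarith
  · refine ⟨c (t - ε), ?_, ?_⟩ <;> rw [hc.dist_eq, Real.dist_eq]
    · rw [abs_of_nonneg] <;> linarith
    · rw [abs_of_nonneg, abs_of_nonneg] <;> linarith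

/-- Without bifurcating geodesics, two points on prolongations of a common nondegenerate
segment `[p, z]` beyond `z`, at the same distance from `p`, coincide. -/
theorem NoBifurcatingGeodesics.eq_of_dist_eq (hbif : NoBifurcatingGeodesics E)
    (hgeo : IsGeodesicSpace E) {p z a b : E} (hz : z ≠ p)
    (ha : dist p z + dist z a = dist p a) (hb : dist p z + dist z b = dist p b)
    (hab : dist p a = dist p b) : a = b := by
  obtain ⟨S, hS, hzS⟩ := hgeo.exists_segment_through ha
  obtain ⟨T, hT, hzT⟩ := hgeo.exists_segment_through hb
  rcases hbif p a b S T hS hT z hzS hzT hz with ⟨rfl, rfl⟩ | h | h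
  · rfl
  · exact hT.eq_of_dist_eq (h hS.right_mem) hab
  · exact (hS.eq_of_dist_eq (h hT.right_mem) hab.symm).symm

end Geodesics

section FarthestPairs

variable {E : Type*} [MetricSpace E]

theorem dist_le_supSetDist {A X : Set E} (hA : IsBounded A) (hX : IsBounded X) {a x : E}
    (ha : a ∈ A) (hx : x ∈ X) : dist a x ≤ supSetDist A X := by
  obtain ⟨C, hC⟩ := isBounded_iff.1 (hA.union hX)
  refine le_csSup ⟨C, ?_⟩ (mem_image2_of_mem ha hx)
  rintro - ⟨b, hb, y, hy, rfl⟩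
  exact hC (Or.inl hb) (Or.inr hy)

theorem supSetDist_eq {A X : Set E} {a₀ x₀ : E} (ha₀ : a₀ ∈ A) (hx₀ : x₀ ∈ X)
    (h : ∀ a ∈ A, ∀ x ∈ X, dist a x ≤ dist a₀ x₀) : supSetDist A X = dist a₀ x₀ := by
  refine IsGreatest.csSup_eq ⟨mem_image2_of_mem ha₀ hx₀, ?_⟩
  rintro - ⟨a, ha, x, hx, rfl⟩
  exact h a ha x hx

theorem IsCompact.exists_farthest_pair {A X : Set E} (hA : IsCompact A) (hX : IsCompact X)
    (hA' : A.Nonempty) (hX' : X.Nonempty) :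
    ∃ a₀ ∈ A, ∃ x₀ ∈ X, ∀ a ∈ A, ∀ x ∈ X, dist a x ≤ dist a₀ x₀ := by
  obtain ⟨⟨a₀, x₀⟩, ⟨ha₀, hx₀⟩, h⟩ := (hA.prod hX).exists_isMaxOn (hA'.prod hX')
    (f := fun p : E × E => dist p.1 p.2) continuous_dist.continuousOn
  exact ⟨a₀, ha₀, x₀, hx₀, fun a ha x hx => isMaxOn_iff.1 h (a, x) ⟨ha, hx⟩⟩

/-- For compact sets, uniqueness of the farthest pair implies well-posedness. -/
theorem MaxWellPosed.of_unique {A X : Set E} (hA : IsCompact A) (hX : IsCompact X) {a₀ x₀ : E}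
    (ha₀ : a₀ ∈ A) (hx₀ : x₀ ∈ X) (hmax : ∀ a ∈ A, ∀ x ∈ X, dist a x ≤ dist a₀ x₀)
    (huniq : ∀ a ∈ A, ∀ x ∈ X, dist a x = dist a₀ x₀ → a = a₀ ∧ x = x₀) :
    MaxWellPosed A X := by
  have hsup := supSetDist_eq ha₀ hx₀ hmax
  refine ⟨a₀, ha₀, x₀, hx₀, hsup.symm, by rwa [hsup], fun a x ha hx hlim => ?_⟩
  rw [← Prod.tendsto_iff (fun n => (a n, x n)) (a₀, x₀)]
  refine (hA.prod hX).tendsto_nhds_of_unique_mapClusterPt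
    (.of_forall fun n => ⟨ha n, hx n⟩) ?_
  rintro ⟨b, y⟩ ⟨hb, hy⟩ hcl
  have hcl' := hcl.continuousAt_comp (f := fun p : E × E => dist p.1 p.2)
    continuous_dist.continuousAt
  have hd : dist b y = supSetDist A X := t2_iff_nhds.1 inferInstance (hcl'.clusterPt.mono hlim)
  obtain ⟨rfl, rfl⟩ := huniq b hb y hy (hd.trans hsup)
  rfl

/-- The pair `(a, x)` maximizes the distance over `A × X` up to an error less than `σ`. -/
def IsNearFarthestPair (A X : Set E) (σ : ℝ) (a x : E) : Prop :=
  a ∈ A ∧ x ∈ X ∧ ∀ b ∈ A, ∀ y ∈ X, dist b y < dist a x + σ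

/-- For some `σ > 0`, the pairs in `A × X` maximizing the distance up to `σ` have
coordinates at mutual distance less than `δ - σ`. -/
def HasSmallNearFarthestPairs (A X : Set E) (δ : ℝ) : Prop :=
  ∃ σ > 0, ∀ a x b y, IsNearFarthestPair A X σ a x → IsNearFarthestPair A X σ b y →
    dist a b + σ < δ ∧ dist x y + σ < δ

theorem isOpen_setOf_hasSmallNearFarthestPairs (A : Set E) (δ : ℝ) :
    IsOpen {X : TopologicalSpace.NonemptyCompacts E |
      HasSmallNearFarthestPairs A (X : Set E) δ} := by
  rw [Metric.isOpen_iff]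
  rintro X ⟨σ, hσ, h⟩
  refine ⟨σ / 4, by positivity, fun Y hY => ⟨σ / 2, by positivity, ?_⟩⟩
  rw [mem_ball, NonemptyCompacts.dist_eq] at hY
  have hfin := hausdorffEDist_ne_top_of_nonempty_of_bounded Y.nonempty X.nonempty
    Y.isCompact.isBounded X.isCompact.isBounded
  have key : ∀ a y, IsNearFarthestPair A Y (σ / 2) a y →
      ∃ x, dist y x < σ / 4 ∧ IsNearFarthestPair A X σ a x := by
    rintro a y ⟨ha, hy, hay⟩
    obtain ⟨x, hx, hyx⟩ := exists_dist_lt_of_hausdorffDist_lt hy hY hfin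
    refine ⟨x, hyx, ha, hx, fun b hb z hz => ?_⟩
    obtain ⟨w, hw, hwz⟩ := exists_dist_lt_of_hausdorffDist_lt' hz hY hfin
    have := hay b hb w hw
    have := dist_triangle b w z
    have := dist_triangle_right a y x
    linarith
  intro a y b z hay hbz
  obtain ⟨x, hyx, hax⟩ := key a y hay
  obtain ⟨w, hzw, hbw⟩ := key b z hbz
  obtain ⟨h₁, h₂⟩ := h a x b w hax hbw
  have := dist_triangle4_right y z x w
  constructor <;> linarith

theorem MaxWellPosed.hasSmallNearFarthestPairs {A X : Set E} (h : MaxWellPosed A X)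
    (hA : IsBounded A) (hX : IsBounded X) {δ : ℝ} (hδ : 0 < δ) :
    HasSmallNearFarthestPairs A X δ := by
  obtain ⟨a₀, ha₀, x₀, hx₀, hd, -, hlim⟩ := h
  by_contra hcon
  simp only [HasSmallNearFarthestPairs, not_exists, not_and] at hcon
  have hu := tendsto_one_div_add_atTop_nhds_zero_nat (𝕜 := ℝ)
  have hcon' (n : ℕ) : ∃ a x b y, IsNearFarthestPair A X (1 / ((n : ℝ) + 1)) a x ∧
      IsNearFarthestPair A X (1 / ((n : ℝ) + 1)) b y ∧
      ¬(dist a b + 1 / ((n : ℝ) + 1) < δ ∧ dist x y + 1 / ((n : ℝ) + 1) < δ) := by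
    simpa only [not_forall, exists_prop] using hcon (1 / ((n : ℝ) + 1)) (by positivity)
  choose a x b y hax hby hbad using hcon'
  have hconv : ∀ a x : ℕ → E, (∀ n : ℕ, IsNearFarthestPair A X (1 / ((n : ℝ) + 1)) (a n) (x n)) →
      Tendsto a atTop (nhds a₀) ∧ Tendsto x atTop (nhds x₀) := by
    intro a x hax
    refine hlim a x (fun n => (hax n).1) (fun n => (hax n).2.1) ?_
    refine tendsto_of_tendsto_of_tendsto_of_le_of_le
      (by simpa only [sub_zero] using tendsto_const_nhds.sub hu) tendsto_const_nhds (fun n => ?_)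
      (fun n => dist_le_supSetDist hA hX (hax n).1 (hax n).2.1)
    have := (hax n).2.2 a₀ ha₀ x₀ hx₀
    dsimp only
    linarith
  obtain ⟨ha, hx⟩ := hconv a x hax
  obtain ⟨hb, hy⟩ := hconv b y hby
  have h₁ := (ha.dist hb).add hu
  have h₂ := (hx.dist hy).add hu
  rw [dist_self, add_zero] at h₁ h₂
  obtain ⟨n, hn⟩ := ((h₁.eventually_lt_const hδ).and (h₂.eventually_lt_const hδ)).exists
  exact hbad n hn

theorem maxWellPosed_iff_forall_hasSmallNearFarthestPairs {A X : Set E} (hA : IsCompact A)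
    (hX : IsCompact X) (hA' : A.Nonempty) (hX' : X.Nonempty) :
    MaxWellPosed A X ↔ ∀ n : ℕ, HasSmallNearFarthestPairs A X (1 / ((n : ℝ) + 1)) := by
  refine ⟨fun h n => h.hasSmallNearFarthestPairs hA.isBounded hX.isBounded (by positivity),
    fun h => ?_⟩
  obtain ⟨a₀, ha₀, x₀, hx₀, hmax⟩ := hA.exists_farthest_pair hX hA' hX'
  refine .of_unique hA hX ha₀ hx₀ hmax fun a ha x hx hax => ?_
  have hsmall (n : ℕ) : dist a a₀ ≤ 1 / ((n : ℝ) + 1) ∧ dist x x₀ ≤ 1 / ((n : ℝ) + 1) := by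
    obtain ⟨σ, hσ, hn⟩ := h n
    obtain ⟨h₁, h₂⟩ := hn a x a₀ x₀
      ⟨ha, hx, fun b hb y hy => by linarith [hmax b hb y hy]⟩
      ⟨ha₀, hx₀, fun b hb y hy => by linarith [hmax b hb y hy]⟩
    constructor <;> linarith
  have hu := tendsto_one_div_add_atTop_nhds_zero_nat (𝕜 := ℝ)
  exact ⟨dist_le_zero.1 (ge_of_tendsto' hu fun n => (hsmall n).1),
    dist_le_zero.1 (ge_of_tendsto' hu fun n => (hsmall n).2)⟩

theorem isGδ_setOf_maxWellPosed {A : Set E} (hA : A.Nonempty) (hAcp : IsCompact A) :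
    IsGδ {X : TopologicalSpace.NonemptyCompacts E | MaxWellPosed A (X : Set E)} := by
  have : {X : TopologicalSpace.NonemptyCompacts E | MaxWellPosed A (X : Set E)} =
      ⋂ n : ℕ, {X : TopologicalSpace.NonemptyCompacts E |
        HasSmallNearFarthestPairs A (X : Set E) (1 / ((n : ℝ) + 1))} := by
    ext X
    simpa only [mem_iInter, mem_ofPred_eq] using
      maxWellPosed_iff_forall_hasSmallNearFarthestPairs hAcp X.isCompact hA X.nonempty
  rw [this]
  exact .iInter_of_isOpen fun n => isOpen_setOf_hasSmallNearFarthestPairs A _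

/-- Adding to `X` a point beyond `x₀` on a prolongation of a longest segment `[a₀, x₀]`
yields a well-posed problem. -/
theorem maxWellPosed_insert (hgeo : IsGeodesicSpace E) (hbif : NoBifurcatingGeodesics E)
    {A X : Set E} (hA : IsCompact A) (hX : IsCompact X) {a₀ x₀ y : E} (ha₀ : a₀ ∈ A)
    (hx₀ : x₀ ∈ X) (hmax : ∀ a ∈ A, ∀ x ∈ X, dist a x ≤ dist a₀ x₀) (hy : x₀ ≠ y)
    (hd : dist a₀ y = dist a₀ x₀ + dist x₀ y) : MaxWellPosed A (insert y X) := by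
  have hpos := dist_pos.2 hy
  have hle : ∀ a ∈ A, dist a y ≤ dist a x₀ + dist x₀ y := fun a _ => dist_triangle _ _ _
  refine .of_unique hA (hX.insert y) ha₀ (mem_insert y X) ?_ ?_
  · rintro a ha x (rfl | hx)
    · linarith [hle a ha, hmax a ha x₀ hx₀]
    · linarith [hmax a ha x hx]
  · rintro a ha x (rfl | hx) hax
    · refine ⟨hbif.eq_of_dist_eq hgeo (p := x) hy ?_ ?_ ?_, rfl⟩
      · rw [dist_comm x x₀, dist_comm x₀ a, dist_comm x a]
        linarith [hle a ha, hmax a ha x₀ hx₀]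
      · rw [dist_comm x x₀, dist_comm x₀ a₀, dist_comm x a₀]
        linarith
      · rwa [dist_comm x a, dist_comm x a₀]
    · linarith [hmax a ha x hx]

theorem dense_setOf_maxWellPosed (hgeo : IsGeodesicSpace E) (hbif : NoBifurcatingGeodesics E)
    (hext : GeodesicExtensionProperty E) {A : Set E} (hA : A.Nonempty) (hAcp : IsCompact A) :
    Dense {X : TopologicalSpace.NonemptyCompacts E | MaxWellPosed A (X : Set E)} := by
  rw [Metric.dense_iff]
  intro X ε hε
  obtain ⟨a₀, ha₀, x₀, hx₀, hmax⟩ := hAcp.exists_farthest_pair X.isCompact hA X.nonempty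
  obtain ⟨y, hxy, hay⟩ := hext.exists_prolongation hgeo a₀ x₀ (half_pos hε).le
  refine ⟨⟨⟨insert y X, X.isCompact.insert y⟩, insert_nonempty _ _⟩, ?_, ?_⟩
  · rw [mem_ball, NonemptyCompacts.dist_eq]
    refine (hausdorffDist_le_of_mem_dist (half_pos hε).le ?_ ?_).trans_lt (half_lt_self hε)
    · rintro z (rfl | hz)
      · exact ⟨x₀, hx₀, by rw [dist_comm, hxy]⟩
      · exact ⟨z, hz, by simpa using (half_pos hε).le⟩
    · exact fun z hz => ⟨z, mem_insert_of_mem y hz, by simpa using (half_pos hε).le⟩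
  · exact maxWellPosed_insert hgeo hbif hAcp X.isCompact ha₀ hx₀ hmax
      (dist_pos.1 (hxy ▸ half_pos hε)) (by rw [hay, hxy])

end FarthestPairs

/-- in a complete geodesic space with no bifurcating geodesics and the
geodesic extension property, for `A` compact, the sets for which `max(A,X)` is
well-posed form a dense `G_δ`-set in `P_{cp}(E)`. -/
theorem statement11 {E : Type*} [MetricSpace E] [CompleteSpace E]
    (hgeo : IsGeodesicSpace E) (hbif : NoBifurcatingGeodesics E)
    (hext : GeodesicExtensionProperty E)
    (A : Set E) (hA : A.Nonempty) (hAcp : IsCompact A) :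
    Dense {X : TopologicalSpace.NonemptyCompacts E | MaxWellPosed A (X : Set E)} ∧
    IsGδ {X : TopologicalSpace.NonemptyCompacts E | MaxWellPosed A (X : Set E)} := by
  exact ⟨dense_setOf_maxWellPosed hgeo hbif hext hA hAcp,
    isGδ_setOf_maxWellPosed hA hAcp⟩
end

section
/- Let (E,‖·‖) be a Banach space, let B be the closed unit ball of E, and let A be a nonempty closed subset of E such that inf{ ‖x‖ : x∈A } > 1. Then there exists a∈A such that co(B ∪ {a}) ∩ A = {a}, where co denotes the convex hull in the Banach space. -/
open Metric Set Filter Bornology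

/-- **Ekeland's variational principle** for a lower semicontinuous function bounded below. -/
theorem LowerSemicontinuous.exists_ekeland {X : Type*} [MetricSpace X] [CompleteSpace X]
    {f : X → ℝ} (hf : LowerSemicontinuous f) (hb : BddBelow (range f)) {ε : ℝ} (hε : 0 < ε)
    (x₀ : X) :
    ∃ a, f a + ε * dist a x₀ ≤ f x₀ ∧ ∀ x, x ≠ a → f a < f x + ε * dist x a := by
  set S : X → Set X := fun x => {y | f y + ε * dist y x ≤ f x} with hS
  have hSself (x : X) : x ∈ S x := by simp [hS]
  have hStrans {x y : X} (hy : y ∈ S x) : S y ⊆ S x := by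
    intro z hz
    simp only [hS, mem_ofPred_eq] at hy hz ⊢
    nlinarith [dist_triangle z y x]
  have hSclosed (x : X) : IsClosed (S x) := by
    have h : LowerSemicontinuous fun y => f y + ε * dist y x :=
      hf.add (by fun_prop : Continuous fun y => ε * dist y x).lowerSemicontinuous
    exact h.isClosed_preimage (f x)
  have hstep (n : ℕ) (x : X) : ∃ y ∈ S x, ∀ z ∈ S x, f y ≤ f z + (1 / 2 : ℝ) ^ n := by
    have hne : (f '' S x).Nonempty := ⟨f x, x, hSself x, rfl⟩
    have hbS : BddBelow (f '' S x) := hb.mono (image_subset_range f _)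
    obtain ⟨_, ⟨y, hy, rfl⟩, hlt⟩ :=
      exists_lt_of_csInf_lt hne (lt_add_of_pos_right (sInf (f '' S x))
        (by positivity : (0 : ℝ) < (1 / 2) ^ n))
    exact ⟨y, hy, fun z hz => by linarith [csInf_le hbS (mem_image_of_mem f hz)]⟩
  choose g hgS hgmin using hstep
  let u : ℕ → X := fun n => Nat.rec x₀ (fun n x => g n x) n
  have hanti : Antitone fun n => S (u n) := antitone_nat_of_succ_le fun n => hStrans (hgS n (u n))
  have hdist (n : ℕ) {y : X} (hy : y ∈ S (u (n + 1))) : dist y (u (n + 1)) ≤ (1 / 2) ^ n / ε := by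
    have h₁ := hgmin n (u n) y (hanti n.le_succ hy)
    have h₂ : f y + ε * dist y (u (n + 1)) ≤ f (g n (u n)) := hy
    rw [le_div_iff₀ hε]
    linarith
  have hlim : Tendsto (fun n : ℕ => (1 / 2 : ℝ) ^ n / ε) atTop (nhds 0) := by
    simpa using (tendsto_pow_atTop_nhds_zero_of_lt_one (r := (1 / 2 : ℝ))
      (by norm_num) (by norm_num)).div_const ε
  have hcauchy : CauchySeq fun n => u (n + 1) :=
    cauchySeq_of_le_tendsto_0' _ (fun n m hnm => by
      rw [dist_comm]
      exact hdist n (hanti (Nat.succ_le_succ hnm) (hSself _))) hlim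
  obtain ⟨a, ha⟩ := cauchySeq_tendsto_of_complete hcauchy
  have haS (n : ℕ) : a ∈ S (u n) :=
    (hSclosed _).mem_of_tendsto ha (eventually_atTop.2
      ⟨n, fun m hm => hanti (Nat.le_succ_of_le hm) (hSself _)⟩)
  refine ⟨a, haS 0, fun x hxa => ?_⟩
  by_contra! hx
  refine hxa (tendsto_nhds_unique (tendsto_iff_dist_tendsto_zero.2 ?_) ha)
  refine squeeze_zero (fun _ => dist_nonneg) (fun n => ?_) hlim
  rw [dist_comm]
  exact hdist n (hStrans (haS (n + 1)) hx)

/-- Daneš' Drop Theorem in Banach spaces. -/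
theorem statement12 {E : Type*} [NormedAddCommGroup E] [NormedSpace ℝ E] [CompleteSpace E]
    (A : Set E) (hA : A.Nonempty) (hAc : IsClosed A)
    (hinf : 1 < sInf ((fun x => ‖x‖) '' A)) :
    ∃ a ∈ A, convexHull ℝ (closedBall (0 : E) 1 ∪ {a}) ∩ A = {a} := by
  obtain ⟨x₀, hx₀⟩ := hA
  set R := sInf ((fun x => ‖x‖) '' A)
  have hR {x : E} (hx : x ∈ A) : R ≤ ‖x‖ :=
    csInf_le ⟨0, by rintro _ ⟨y, -, rfl⟩; exact norm_nonneg y⟩ (mem_image_of_mem _ hx)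
  have hM : 0 < 1 + ‖x₀‖ := by positivity
  have hε : 0 < (R - 1) / (1 + ‖x₀‖) := div_pos (by linarith) hM
  have : CompleteSpace A := hAc.completeSpace_coe
  obtain ⟨⟨a, haA⟩, ha₀, ha⟩ := LowerSemicontinuous.exists_ekeland
    (f := fun x : A => ‖(x : E)‖) (by fun_prop : Continuous _).lowerSemicontinuous
    ⟨0, by rintro _ ⟨y, rfl⟩; exact norm_nonneg _⟩ hε ⟨x₀, hx₀⟩
  set ε := (R - 1) / (1 + ‖x₀‖) with hε_def
  have hεM : ε * (1 + ‖x₀‖) = R - 1 := div_mul_cancel₀ _ hM.ne'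
  have haM : ‖a‖ ≤ ‖x₀‖ := by
    have := mul_nonneg hε.le (dist_nonneg (x := (⟨a, haA⟩ : A)) (y := ⟨x₀, hx₀⟩))
    simp only at ha₀
    linarith
  refine ⟨a, haA, Subset.antisymm ?_ ?_⟩
  · rintro x ⟨hx, hxA⟩
    by_contra hxa
    have hlt : ‖a‖ < ‖x‖ + ε * ‖x - a‖ := by
      simpa [Subtype.dist_eq, dist_eq_norm] using ha ⟨x, hxA⟩ fun h => hxa (congrArg Subtype.val h)
    rw [union_singleton, convexHull_insert (nonempty_closedBall.2 zero_le_one),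
      (convex_closedBall (0 : E) 1).convexHull_eq, mem_convexJoin] at hx
    obtain ⟨a', ha', b, hb, s, t, hs, ht, hst, rfl⟩ := hx
    obtain rfl : a = a' := (mem_singleton_iff.1 ha').symm
    rw [mem_closedBall_zero_iff] at hb
    have hnorm : ‖s • a + t • b‖ ≤ s * ‖a‖ + t := by
      calc ‖s • a + t • b‖ ≤ ‖s • a‖ + ‖t • b‖ := norm_add_le _ _
        _ = s * ‖a‖ + t * ‖b‖ := by rw [norm_smul_of_nonneg hs, norm_smul_of_nonneg ht]
        _ ≤ s * ‖a‖ + t := by nlinarith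
    have hdiff : ‖s • a + t • b - a‖ ≤ t * (1 + ‖x₀‖) := by
      have : s • a + t • b - a = t • (b - a) := by
        rw [← eq_sub_iff_add_eq] at hst
        rw [hst]
        module
      rw [this, norm_smul_of_nonneg ht]
      exact mul_le_mul_of_nonneg_left (by linarith [norm_sub_le b a]) ht
    have hs_eq : s * ‖a‖ = ‖a‖ - t * ‖a‖ := by rw [← sub_eq_iff_eq_add.2 hst.symm]; ring
    have h₁ := mul_le_mul_of_nonneg_left hdiff hε.le
    have h₂ := mul_le_mul_of_nonneg_left (hR haA) ht
    have h₃ : ε * (t * (1 + ‖x₀‖)) = t * (R - 1) := by rw [← hεM]; ring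
    linarith
  · rintro _ rfl
    exact ⟨subset_convexHull ℝ _ (Or.inr rfl), haA⟩
end

section
/- Let (E,d) be a complete metric space, A a nonempty closed subset of E, and f:E→ℝ a Lipschitz function that is bounded below on A. Let δ>0, α>0 and x₀∈A. Then there exists a point a ∈ A ∩ P_{α,δ}(x₀,f) such that (i) P_{α,0}(a,f) ∩ A = {a}, and (ii) every sequence (x_n) in P_{α,0}(a,f) with dist(x_n,A)→0 converges to a. -/
open Metric Set Filter Bornology

/-- **Ekeland's variational principle** on a closed subset of a complete metric space. -/
theorem exists_ekeland_point {E : Type*} [MetricSpace E] [CompleteSpace E] {A : Set E}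
    (hA : IsClosed A) {f : E → ℝ} (hf : LowerSemicontinuous f) (hbdd : BddBelow (f '' A))
    {β : ℝ} (hβ : 0 < β) {x₀ : E} (hx₀ : x₀ ∈ A) :
    ∃ a ∈ A, f a + β * dist a x₀ ≤ f x₀ ∧ ∀ y ∈ A, y ≠ a → f a < f y + β * dist y a := by
  let S : E → Set E := fun x => {y ∈ A | f y + β * dist y x ≤ f x}
  have S_self : ∀ x ∈ A, x ∈ S x := fun x hx => ⟨hx, by simp⟩
  have S_trans : ∀ {x y z}, y ∈ S x → z ∈ S y → z ∈ S x := by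
    intro x y z hy hz
    refine ⟨hz.1, ?_⟩
    have h₁ := hy.2
    have h₂ := hz.2
    have h₃ := mul_le_mul_of_nonneg_left (dist_triangle z y x) hβ.le
    linarith
  have S_closed : ∀ x, IsClosed (S x) := by
    intro x
    have hg : Continuous fun y => β * dist y x := by fun_prop
    exact hA.inter ((hf.add hg.lowerSemicontinuous).isClosed_preimage (f x))
  have step : ∀ (n : ℕ) (x : A), ∃ y : A, (y : E) ∈ S x ∧ ∀ z ∈ S x, f y ≤ f z + (1 / 2) ^ n := by
    intro n x
    have hne : (f '' S x).Nonempty := ⟨_, mem_image_of_mem f (S_self x x.2)⟩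
    have hb : BddBelow (f '' S x) := hbdd.mono (image_mono fun y hy => hy.1)
    obtain ⟨_, ⟨y, hy, rfl⟩, hlt⟩ :=
      exists_lt_of_csInf_lt hne (lt_add_of_pos_right (sInf (f '' S x))
        (by positivity : (0 : ℝ) < (1 / 2) ^ n))
    refine ⟨⟨y, hy.1⟩, hy, fun z hz => ?_⟩
    have := csInf_le hb (mem_image_of_mem f hz)
    linarith
  choose next next_mem next_le using step
  obtain ⟨u, u_zero, u_succ⟩ : ∃ u : ℕ → A, u 0 = ⟨x₀, hx₀⟩ ∧ ∀ n, u (n + 1) = next n (u n) :=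
    ⟨fun n => Nat.rec ⟨x₀, hx₀⟩ next n, rfl, fun _ => rfl⟩
  have u_mem : ∀ n m : ℕ, n ≤ m → (u m : E) ∈ S (u n) := by
    intro n m hnm
    induction m, hnm using Nat.le_induction with
    | base => exact S_self _ (u n).2
    | succ m _ ih => exact S_trans ih (u_succ m ▸ next_mem m (u m))
  have dist_le : ∀ n : ℕ, ∀ y ∈ S (u (n + 1)), dist y (u (n + 1)) ≤ (1 / 2) ^ n / β := by
    intro n y hy
    have h₁ : f (u (n + 1)) ≤ f y + (1 / 2) ^ n :=
      u_succ n ▸ next_le n (u n) y (S_trans (u_mem n (n + 1) n.le_succ) hy)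
    have h₂ := hy.2
    rw [le_div_iff₀ hβ]
    linarith
  have lim_bound : Tendsto (fun n : ℕ => (1 / 2 : ℝ) ^ n / β) atTop (nhds 0) := by
    simpa using (tendsto_pow_atTop_nhds_zero_of_lt_one (r := (1 / 2 : ℝ))
      (by norm_num) (by norm_num)).div_const β
  have u_cauchy : CauchySeq fun n => (u (n + 1) : E) :=
    cauchySeq_of_le_tendsto_0' _
      (fun n m hnm => by
        rw [dist_comm]
        exact dist_le n _ (u_mem (n + 1) (m + 1) (by omega))) lim_bound
  obtain ⟨a, ha⟩ := cauchySeq_tendsto_of_complete u_cauchy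
  have a_mem : ∀ n : ℕ, a ∈ S (u n) := fun n =>
    (S_closed _).mem_of_tendsto ha
      (eventually_atTop.2 ⟨n, fun m hm => u_mem n (m + 1) (by omega)⟩)
  refine ⟨a, (a_mem 0).1, by simpa [u_zero] using (a_mem 0).2, fun y hy hya => ?_⟩
  by_contra! h
  have hyu : Tendsto (fun n => (u (n + 1) : E)) atTop (nhds y) := by
    rw [tendsto_iff_dist_tendsto_zero]
    refine squeeze_zero (fun _ => dist_nonneg) (fun n => ?_) lim_bound
    rw [dist_comm]
    exact dist_le n y (S_trans (a_mem (n + 1)) ⟨hy, h⟩)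
  exact hya (tendsto_nhds_unique hyu ha)

/-- If `a` minimizes `y ↦ f y + β * dist y a` on `A` and `β < α`, then every sequence in the petal
of parameter `α` at `a` whose distance to `A` tends to zero converges to `a`. -/
theorem tendsto_of_mem_petal {E : Type*} [MetricSpace E] {A : Set E} {f : E → ℝ} {K : NNReal}
    (hf : LipschitzWith K f) {α β : ℝ} (hβ : 0 ≤ β) (hβα : β < α) {a : E} (ha : a ∈ A)
    (hmin : ∀ y ∈ A, f a ≤ f y + β * dist y a) {x : ℕ → E} (hx : ∀ n, x n ∈ petal f α 0 a)
    (hxA : Tendsto (fun n => infDist (x n) A) atTop (nhds 0)) : Tendsto x atTop (nhds a) := by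
  have key : ∀ z, f a ≤ f z + β * dist z a + (K + β) * infDist z A := by
    intro z
    refine le_of_forall_pos_le_add fun ε hε => ?_
    have hc : (0 : ℝ) < K + β + 1 := by positivity
    obtain ⟨y, hy, hzy⟩ := (infDist_lt_iff ⟨a, ha⟩).1
      (lt_add_of_pos_right (infDist z A) (div_pos hε hc))
    have h₁ := hmin y hy
    have h₂ := (le_abs_self _).trans (hf.dist_le_mul y z)
    have h₃ := mul_le_mul_of_nonneg_left (dist_triangle_left y a z) hβ
    have h₄ : (K + β) * dist z y ≤ (K + β) * (infDist z A + ε / (K + β + 1)) := by gcongr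
    have h₅ : (K + β) * (ε / (K + β + 1)) ≤ ε := by
      rw [mul_div_assoc', div_le_iff₀ hc]
      nlinarith
    rw [dist_comm y z] at h₂
    linarith
  rw [tendsto_iff_dist_tendsto_zero]
  have hlim : Tendsto (fun n => (K + β) / (α - β) * infDist (x n) A) atTop (nhds 0) := by
    simpa using hxA.const_mul ((K + β) / (α - β))
  refine squeeze_zero (fun _ => dist_nonneg) (fun n => ?_) hlim
  have h₁ : f (x n) ≤ f a - α * dist (x n) a + 0 := hx n
  have h₂ := key (x n)
  rw [div_mul_eq_mul_div, le_div_iff₀ (sub_pos.2 hβα)]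
  linarith

/-- Strong Flower Petal Theorem. -/
theorem statement13 {E : Type*} [MetricSpace E] [CompleteSpace E]
    (A : Set E) (hA : A.Nonempty) (hAc : IsClosed A)
    (f : E → ℝ) (hf : ∃ K : NNReal, LipschitzWith K f) (hbdd : BddBelow (f '' A))
    (δ α : ℝ) (hδ : 0 < δ) (hα : 0 < α) (x₀ : E) (hx₀ : x₀ ∈ A) :
    ∃ a ∈ A ∩ petal f α δ x₀,
      petal f α 0 a ∩ A = {a} ∧
      ∀ x : ℕ → E, (∀ n, x n ∈ petal f α 0 a) →
        Tendsto (fun n => infDist (x n) A) atTop (nhds 0) →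
        Tendsto x atTop (nhds a) := by
  obtain ⟨K, hK⟩ := hf
  obtain ⟨m, hm⟩ := id hbdd
  have hfm : ∀ y ∈ A, m ≤ f y := fun y hy => hm (mem_image_of_mem f hy)
  have hM : 0 ≤ f x₀ - m := sub_nonneg.2 (hfm x₀ hx₀)
  have hD : 0 < f x₀ - m + δ := by linarith
  obtain ⟨β, hβ, hβα, hβδ⟩ : ∃ β, 0 < β ∧ β < α ∧ (α - β) * (f x₀ - m) ≤ β * δ := by
    refine ⟨α * (f x₀ - m + δ / 2) / (f x₀ - m + δ), by positivity, ?_, ?_⟩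
    · rw [div_lt_iff₀ hD]
      nlinarith
    · have hβ : α * (f x₀ - m + δ / 2) / (f x₀ - m + δ) * (f x₀ - m + δ) =
          α * (f x₀ - m + δ / 2) := div_mul_cancel₀ _ hD.ne'
      nlinarith
  obtain ⟨a, haA, hax₀, hmin⟩ :=
    exists_ekeland_point hAc hK.continuous.lowerSemicontinuous hbdd hβ hx₀
  have hmin' : ∀ y ∈ A, f a ≤ f y + β * dist y a := by
    intro y hy
    rcases eq_or_ne y a with rfl | hya
    · simp
    · exact (hmin y hy hya).le
  refine ⟨a, ⟨haA, ?_⟩, ?_, fun x hx hxA => tendsto_of_mem_petal hK hβ.le hβα haA hmin' hx hxA⟩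
  · have h₁ : β * dist a x₀ ≤ f x₀ - m := by linarith [hfm a haA]
    have h₂ : (α - β) * dist a x₀ ≤ δ := by
      have h₃ := mul_le_mul_of_nonneg_left h₁ (sub_nonneg.2 hβα.le)
      refine le_of_mul_le_mul_left ?_ hβ
      linarith
    change f a ≤ f x₀ - α * dist a x₀ + δ
    linarith
  · refine Subset.antisymm (fun y hy => ?_) (singleton_subset_iff.2 ⟨by simp [petal], haA⟩)
    by_contra hya
    have h₁ : f y ≤ f a - α * dist y a + 0 := hy.1
    have h₂ := hmin y hy.2 hya
    have h₃ := mul_le_mul_of_nonneg_right hβα.le (dist_nonneg (x := y) (y := a))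
    linarith
end

section
/- Let (E,d) be a complete geodesic space with convex metric, let A be a nonempty closed subset of E and B a nonempty, bounded, closed and convex subset of E such that λ_{AB} > 0, and let ε>0. Then there exists a∈A such that (i) dist(a,B) < λ_{AB} + ε, (ii) cō(B ∪ {a}) ∩ A = {a}, and (iii) every sequence (x_n) in cō(B ∪ {a}) with dist(x_n,A)→0 converges to a. -/
open Metric Set Filter Bornology

/-- A point of a geodesic segment has an affine parameter in `[0, 1]`. -/
theorem IsGeodesicSegment.exists_param {E : Type*} [MetricSpace E] {S : Set E} {x y z : E}
    (hS : IsGeodesicSegment S x y) (hz : z ∈ S) :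
    ∃ (c : ℝ → E) (l t : ℝ), IsGeodesicPath c l ∧ c 0 = x ∧ c l = y ∧ t ∈ Icc (0:ℝ) 1 ∧
      c (t * l) = z := by
  obtain ⟨c, l, hc, h0, h1, rfl⟩ := hS
  obtain ⟨s, ⟨hs0, hsl⟩, rfl⟩ := hz
  rcases hc.1.eq_or_lt with hl | hl
  · refine ⟨c, l, 0, hc, h0, h1, ⟨le_rfl, zero_le_one⟩, ?_⟩
    rw [zero_mul, le_antisymm (hl ▸ hsl) hs0]
  · exact ⟨c, l, s / l, hc, h0, h1, ⟨by positivity, (div_le_one hl).2 hsl⟩,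
      by rw [div_mul_cancel₀ _ hl.ne']⟩

theorem GeodesicConvexFun.geodesicConvex_le {E : Type*} [MetricSpace E] {f : E → ℝ}
    (hf : GeodesicConvexFun f) (r : ℝ) : GeodesicConvex {x | f x ≤ r} := by
  intro x hx y hy S hS z hz
  obtain ⟨c, l, t, hc, rfl, rfl, ht, rfl⟩ := hS.exists_param hz
  have h := hf c l hc t ht
  have h0 := mul_le_mul_of_nonneg_left (show f (c 0) ≤ r from hx) (sub_nonneg.2 ht.2)
  have h1 := mul_le_mul_of_nonneg_left (show f (c l) ≤ r from hy) ht.1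
  change f (c (t * l)) ≤ r
  linarith

theorem GeodesicConvexFun.add_const_mul {E : Type*} [MetricSpace E] {f g : E → ℝ}
    (hf : GeodesicConvexFun f) (hg : GeodesicConvexFun g) {α : ℝ} (hα : 0 ≤ α) :
    GeodesicConvexFun fun x => f x + α * g x := by
  intro c l hc t ht
  have h := mul_le_mul_of_nonneg_left (hg c l hc t ht) hα
  linarith [hf c l hc t ht]

theorem HasConvexMetric.geodesicConvexFun_dist {E : Type*} [MetricSpace E]
    (hconv : HasConvexMetric E) (a : E) : GeodesicConvexFun fun x => dist x a := by
  intro c l hc t ht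
  have ha : IsGeodesicPath (fun _ => a) 0 := by
    refine ⟨le_rfl, fun s hs u hu => ?_⟩
    rw [le_antisymm hs.2 hs.1, le_antisymm hu.2 hu.1]
    simp
  exact hconv c _ l 0 hc ha t ht

theorem HasConvexMetric.geodesicConvexFun_infDist {E : Type*} [MetricSpace E]
    (hgeo : IsGeodesicSpace E) (hconv : HasConvexMetric E) {B : Set E} (hB : B.Nonempty)
    (hBcv : GeodesicConvex B) : GeodesicConvexFun fun x => infDist x B := by
  intro c l hc t ht
  refine le_of_forall_pos_lt_add fun δ hδ => ?_
  obtain ⟨p, hp, hp'⟩ := (infDist_lt_iff hB).1 (lt_add_of_pos_right (infDist (c 0) B) hδ)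
  obtain ⟨q, hq, hq'⟩ := (infDist_lt_iff hB).1 (lt_add_of_pos_right (infDist (c l) B) hδ)
  obtain ⟨S, hS⟩ := hgeo p q
  have hSB := hBcv p hp q hq S hS
  obtain ⟨c', l', hc', rfl, rfl, rfl⟩ := hS
  have hmem : c' (t * l') ∈ B :=
    hSB ⟨_, ⟨mul_nonneg ht.1 hc'.1, mul_le_of_le_one_left hc'.1 ht.2⟩, rfl⟩
  have h := (infDist_le_dist_of_mem hmem).trans (hconv c c' l l' hc hc' t ht)
  rcases ht.1.eq_or_lt with rfl | ht0
  · simp only [zero_mul, sub_zero, one_mul, add_zero] at h ⊢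
    linarith
  · have h0 := mul_le_mul_of_nonneg_left hp'.le (sub_nonneg.2 ht.2)
    have h1 := mul_lt_mul_of_pos_left hq' ht0
    linarith

theorem GeodesicConvex.geodConvexHull_subset {E : Type*} [MetricSpace E] {S C : Set E}
    (hC : GeodesicConvex C) (hS : S ⊆ C) : geodConvexHull S ⊆ C := by
  refine iUnion_subset fun n => ?_
  induction n with
  | zero => exact hS
  | succ n ih =>
    rintro z ⟨x, hx, y, hy, T, hT, hz⟩
    exact hC x (ih hx) y (ih hy) T hT hz

/-- Ekeland's variational principle for a continuous function bounded below on a closed subset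
of a complete metric space. -/
theorem exists_ekeland_of_isClosed {E : Type*} [MetricSpace E] [CompleteSpace E] {A : Set E}
    (hA : IsClosed A) {f : E → ℝ} (hf : Continuous f) (hbdd : BddBelow (f '' A)) {a₀ : E}
    (ha₀ : a₀ ∈ A) {α : ℝ} (hα : 0 < α) :
    ∃ a ∈ A, f a ≤ f a₀ ∧ ∀ y ∈ A, f a ≤ f y + α * dist y a := by
  let S : E → Set E := fun x => {y ∈ A | f y + α * dist y x ≤ f x}
  have hself : ∀ x ∈ A, x ∈ S x := fun x hx => ⟨hx, by simp⟩
  have htrans : ∀ x, ∀ y ∈ S x, S y ⊆ S x := by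
    intro x y hy z hz
    have h := mul_le_mul_of_nonneg_left (dist_triangle z y x) hα.le
    exact ⟨hz.1, by linarith [hy.2, hz.2]⟩
  have hclosed : ∀ x, IsClosed (S x) := fun x =>
    hA.inter (isClosed_le (f := fun y => f y + α * dist y x) (by fun_prop) continuous_const)
  have hstep : ∀ (n : ℕ) (x : A), ∃ y : A, (y : E) ∈ S x ∧
      ∀ z ∈ S x, f y ≤ f z + (1 / 2 : ℝ) ^ n := by
    intro n x
    have hne : (f '' S x).Nonempty := ⟨_, _, hself x x.2, rfl⟩
    have hb : BddBelow (f '' S x) := hbdd.mono (image_mono fun _ h => h.1)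
    obtain ⟨_, ⟨y, hy, rfl⟩, hlt⟩ := exists_lt_of_csInf_lt hne
      (lt_add_of_pos_right (sInf (f '' S x)) (show (0:ℝ) < (1 / 2) ^ n by positivity))
    exact ⟨⟨y, hy.1⟩, hy, fun z hz => by linarith [csInf_le hb ⟨z, hz, rfl⟩]⟩
  choose g hgS hgmin using hstep
  obtain ⟨u, hu0, hu⟩ : ∃ u : ℕ → A, u 0 = ⟨a₀, ha₀⟩ ∧ ∀ n, u (n + 1) = g n (u n) :=
    ⟨fun n => Nat.rec ⟨a₀, ha₀⟩ (fun n x => g n x) n, rfl, fun _ => rfl⟩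
  have hanti : Antitone fun n : ℕ => S (u n).1 :=
    antitone_nat_of_succ_le fun n => htrans _ _ (by rw [hu]; exact hgS n (u n))
  have hsmall : ∀ n, ∀ z ∈ S (u (n + 1)), dist z (u (n + 1)) ≤ (1 / 2 : ℝ) ^ n / α := by
    intro n z hz
    have h := hgmin n (u n) z (hanti n.le_succ hz)
    rw [← hu] at h
    rw [le_div_iff₀ hα]
    linarith [hz.2]
  have hlim : Tendsto (fun n : ℕ => (1 / 2 : ℝ) ^ n / α) atTop (nhds 0) := by
    simpa using (tendsto_pow_atTop_nhds_zero_of_lt_one (r := (1 / 2 : ℝ)) (by norm_num)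
      (by norm_num)).div_const α
  have hcauchy : CauchySeq fun n => (u (n + 1) : E) :=
    cauchySeq_of_le_tendsto_0' _ (fun n m hnm => by
      rw [dist_comm]
      exact hsmall n _ (hanti (Nat.succ_le_succ hnm) (hself _ (u (m + 1)).2))) hlim
  obtain ⟨a, ha⟩ := cauchySeq_tendsto_of_complete hcauchy
  have haS : ∀ n, a ∈ S (u (n + 1)) := fun n =>
    (hclosed _).mem_of_tendsto ha (eventually_atTop.2
      ⟨n, fun m hm => hanti (Nat.succ_le_succ hm) (hself _ (u (m + 1)).2)⟩)
  have ha0 : a ∈ S a₀ := by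
    simpa only [hu0] using hanti (Nat.zero_le 1) (haS 0)
  refine ⟨a, ha0.1, by nlinarith [ha0.2, dist_nonneg (x := a) (y := a₀)], fun y hy => ?_⟩
  by_contra! hlt
  have hya : y ∈ S a := ⟨hy, hlt.le⟩
  have hy_lim : Tendsto (fun n => (u (n + 1) : E)) atTop (nhds y) := by
    rw [tendsto_iff_dist_tendsto_zero]
    refine squeeze_zero (fun _ => dist_nonneg) (fun n => ?_) hlim
    rw [dist_comm]
    exact hsmall n y (htrans _ _ (haS n) hya)
  rw [tendsto_nhds_unique hy_lim ha] at hlt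
  simp at hlt

theorem infSetDist_le_infDist {E : Type*} [MetricSpace E] {A B : Set E} (hB : B.Nonempty) {a : E}
    (ha : a ∈ A) : infSetDist A B ≤ infDist a B :=
  (le_infDist hB).2 fun _ hb =>
    csInf_le ⟨0, by rintro _ ⟨_, _, _, _, rfl⟩; exact dist_nonneg⟩ (mem_image2_of_mem ha hb)

theorem exists_infDist_lt_infSetDist_add {E : Type*} [MetricSpace E] {A B : Set E}
    (hA : A.Nonempty) (hB : B.Nonempty) {ε : ℝ} (hε : 0 < ε) :
    ∃ a ∈ A, infDist a B < infSetDist A B + ε := by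
  obtain ⟨_, ⟨a, ha, b, hb, rfl⟩, h⟩ := exists_lt_of_csInf_lt (hA.image2 hB)
    (lt_add_of_pos_right (infSetDist A B) hε)
  exact ⟨a, ha, (infDist_le_dist_of_mem hb).trans_lt h⟩

/-- The closed convex hull of `B ∪ {a}` lies in a petal with vertex `a` of the distance
function to `B`. -/
theorem HasConvexMetric.closure_geodConvexHull_subset_petal {E : Type*} [MetricSpace E]
    (hgeo : IsGeodesicSpace E) (hconv : HasConvexMetric E) {B : Set E} (hB : B.Nonempty)
    (hBb : IsBounded B) (hBcv : GeodesicConvex B) {a : E} {r : ℝ} (hr : 0 < r)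
    (ha : r ≤ infDist a B) :
    closure (geodConvexHull (B ∪ {a})) ⊆
      petal (fun x => infDist x B) (r / (r + diam B)) 0 a := by
  have hD : 0 ≤ diam B := diam_nonneg
  have hα : 0 ≤ r / (r + diam B) := by positivity
  have hpetal : petal (fun x => infDist x B) (r / (r + diam B)) 0 a =
      {x | infDist x B + r / (r + diam B) * dist x a ≤ infDist a B} := by
    ext x
    simp only [petal, mem_ofPred_eq, add_zero, le_sub_iff_add_le]
  rw [hpetal]
  refine closure_minimal (GeodesicConvex.geodConvexHull_subset
    (((hconv.geodesicConvexFun_infDist hgeo hB hBcv).add_const_mul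
      (hconv.geodesicConvexFun_dist a) hα).geodesicConvex_le _) ?_)
    (isClosed_le ((continuous_infDist_pt B).add
      (continuous_const.mul (continuous_id.dist continuous_const))) continuous_const)
  rintro x (hx | rfl)
  · have hdist : dist x a ≤ infDist a B + diam B := by
      rw [← sub_le_iff_le_add]
      refine (le_infDist hB).2 fun b hb => ?_
      linarith [dist_triangle x b a, dist_le_diam_of_mem hBb hx hb, dist_comm a b]
    rw [mem_ofPred_eq, infDist_zero_of_mem hx, zero_add, div_mul_eq_mul_div,
      div_le_iff₀ (by positivity)]
    nlinarith
  · simp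

/-- Drop Theorem in geodesic spaces with convex metric. -/
theorem statement14 {E : Type*} [MetricSpace E] [CompleteSpace E]
    (hgeo : IsGeodesicSpace E) (hconv : HasConvexMetric E)
    (A B : Set E) (hA : A.Nonempty) (hAc : IsClosed A)
    (hB : B.Nonempty) (hBb : IsBounded B) (hBc : IsClosed B) (hBcv : GeodesicConvex B)
    (hlam : 0 < infSetDist A B) (ε : ℝ) (hε : 0 < ε) :
    ∃ a ∈ A, infDist a B < infSetDist A B + ε ∧
      closure (geodConvexHull (B ∪ {a})) ∩ A = {a} ∧
      ∀ x : ℕ → E, (∀ n, x n ∈ closure (geodConvexHull (B ∪ {a}))) →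
        Tendsto (fun n => infDist (x n) A) atTop (nhds 0) →
        Tendsto x atTop (nhds a) := by
  set α := infSetDist A B / (infSetDist A B + diam B) with hα_def
  have hα : 0 < α := div_pos hlam (add_pos_of_pos_of_nonneg hlam diam_nonneg)
  obtain ⟨a₀, ha₀, ha₀ε⟩ := exists_infDist_lt_infSetDist_add hA hB hε
  obtain ⟨a, ha, haa₀, hmin⟩ := exists_ekeland_of_isClosed hAc (continuous_infDist_pt B)
    ⟨0, by rintro _ ⟨x, _, rfl⟩; exact infDist_nonneg⟩ ha₀ (half_pos hα)
  have hpetal := hconv.closure_geodConvexHull_subset_petal hgeo hB hBb hBcv hlam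
    (infSetDist_le_infDist hB ha)
  rw [← hα_def] at hpetal
  have hwell : ∀ x ∈ closure (geodConvexHull (B ∪ {a})),
      dist x a ≤ 2 / α * (1 + α / 2) * infDist x A := by
    intro x hx
    have hx' := hpetal hx
    simp only [petal, mem_ofPred_eq, add_zero] at hx'
    have hkey : α / 2 * dist x a / (1 + α / 2) ≤ infDist x A := by
      refine (le_infDist hA).2 fun y hy => ?_
      rw [div_le_iff₀ (by positivity)]
      have h := mul_le_mul_of_nonneg_left (dist_triangle y x a) (half_pos hα).le
      have hyx : infDist y B ≤ infDist x B + dist x y := by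
        rw [dist_comm]
        exact infDist_le_infDist_add_dist
      rw [dist_comm y x] at h
      linarith [hmin y hy]
    rw [div_le_iff₀ (by positivity)] at hkey
    calc dist x a = 2 / α * (α / 2 * dist x a) := by field_simp
      _ ≤ 2 / α * (infDist x A * (1 + α / 2)) := by gcongr
      _ = _ := by ring
  refine ⟨a, ha, haa₀.trans_lt ha₀ε, ?_, fun x hx hxA => ?_⟩
  · refine Subset.antisymm (fun x hx => ?_) (singleton_subset_iff.2
      ⟨subset_closure (mem_iUnion.2 ⟨0, Or.inr rfl⟩), ha⟩)
    have h := hwell x hx.1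
    rw [infDist_zero_of_mem hx.2, mul_zero] at h
    exact dist_le_zero.1 h
  · rw [tendsto_iff_dist_tendsto_zero]
    exact squeeze_zero (fun _ => dist_nonneg) (fun n => hwell _ (hx n))
      (by simpa using hxA.const_mul (2 / α * (1 + α / 2)))
end

section
/- Let E be a geodesic space, X a bounded subset of E and f:E→ℝ continuous and convex. For c∈ℝ, let A = { x∈E : f(x) ≤ c }, and suppose there exists z∈E with f(z) < c. Then for every ε>0 there exists δ>0 such that dist(x,A) < ε for each x∈X with f(x) < c + δ. -/
open Metric Set Filter Bornology

/-- sublevel-set approximation for continuous convex functions. -/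
theorem statement15 {E : Type*} [MetricSpace E] (hgeo : IsGeodesicSpace E)
    (X : Set E) (hXb : IsBounded X) (f : E → ℝ) (hfc : Continuous f)
    (hfcv : GeodesicConvexFun f) (c : ℝ) (hz : ∃ z : E, f z < c) :
    ∀ ε > (0:ℝ), ∃ δ > (0:ℝ), ∀ x ∈ X, f x < c + δ →
      infDist x {y : E | f y ≤ c} < ε := by
  intro ε hε
  obtain ⟨z, hz⟩ := hz
  obtain ⟨R, hR0, hR⟩ : ∃ R > (0:ℝ), X ⊆ ball z R := hXb.subset_ball_lt 0 z
  have hm : 0 < c - f z := sub_pos.2 hz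
  refine ⟨ε * (c - f z) / R, by positivity, fun x hx hfx => ?_⟩
  set δ := ε * (c - f z) / R with hδ
  have hδ0 : 0 < δ := by positivity
  have hδR : δ * R = ε * (c - f z) := by rw [hδ]; field_simp
  obtain ⟨-, γ, l, hγ, rfl, rfl, -⟩ := hgeo x z
  have hl : l < R := by
    have h := hγ.2 0 ⟨le_rfl, hγ.1⟩ l ⟨hγ.1, le_rfl⟩
    rw [zero_sub, abs_neg, abs_of_nonneg hγ.1] at h
    exact h ▸ mem_ball.1 (hR hx)
  have hs : 0 < δ + (c - f (γ l)) := by positivity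
  set t := δ / (δ + (c - f (γ l))) with ht
  have ht0 : 0 < t := by positivity
  have ht1 : t ≤ 1 := (div_le_one hs).2 (by linarith)
  have hts : t * (δ + (c - f (γ l))) = δ := div_mul_cancel₀ _ hs.ne'
  have hmem : f (γ (t * l)) ≤ c := by
    have h := hfcv γ l hγ t ⟨ht0.le, ht1⟩
    nlinarith [mul_le_mul_of_nonneg_left hfx.le (sub_nonneg.2 ht1)]
  have htl : 0 ≤ t * l := mul_nonneg ht0.le hγ.1
  calc infDist (γ 0) {y | f y ≤ c} ≤ dist (γ 0) (γ (t * l)) := infDist_le_dist_of_mem hmem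
    _ = t * l := by
      rw [hγ.2 0 ⟨le_rfl, hγ.1⟩ (t * l) ⟨htl, mul_le_of_le_one_left hγ.1 ht1⟩, zero_sub,
        abs_neg, abs_of_nonneg htl]
    _ < t * R := by gcongr
    _ < ε := by
      rw [ht, div_mul_eq_mul_div, div_lt_iff₀ hs, hδR]
      nlinarith [mul_pos hε hδ0]
end
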